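/- arXiv:2205.13789 — 6 statements merged into one kernel-verified Lean document; each statement's English description precedes it below -/
import Mathlib

section
/- Let ε > 0 be a tolerance threshold, 𝒜 a finite nonempty set of candidate anchors with length function |·|, and p : 𝒜 → ℝ an evaluation function such that 𝒜₁^p(ε) is nonempty. Let A* ∈ 𝒜₃^p(ε). Assume that (i) p(A*) ≥ 1 − ε/4, and (ii) p(A) ≤ 1 − 3ε/4 for every A ∈ 𝒜₂^p(ε) with A ≠ A*. Let q : 𝒜 → ℝ be another evaluation function and set δ := sup_{A ∈ 𝒜} |p(A) − q(A)|; assume δ < ε/4. Then 𝒜₃^q(ε − δ) = {A*}. -/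
open Classical in
/-- `𝒜₁^p(ε)`: the anchors of `𝒜` with `p`-value at least `1 - ε`. -/
noncomputable def anchorsA1 {α : Type*} (𝒜 : Finset α) (p : α → ℝ) (ε : ℝ) : Finset α :=
  𝒜.filter fun A => 1 - ε ≤ p A

open Classical in
/-- `𝒜₂^p(ε)`: the anchors of `𝒜₁^p(ε)` of minimal length. -/
noncomputable def anchorsA2 {α : Type*} (𝒜 : Finset α) (len : α → ℕ) (p : α → ℝ) (ε : ℝ) :
    Finset α :=
  (anchorsA1 𝒜 p ε).filter fun A => ∀ B ∈ anchorsA1 𝒜 p ε, len A ≤ len B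

open Classical in
/-- `𝒜₃^p(ε)`: the anchors of `𝒜₂^p(ε)` with maximal `p`-value. -/
noncomputable def anchorsA3 {α : Type*} (𝒜 : Finset α) (len : α → ℕ) (p : α → ℝ) (ε : ℝ) :
    Finset α :=
  (anchorsA2 𝒜 len p ε).filter fun A => ∀ B ∈ anchorsA2 𝒜 len p ε, p B ≤ p A

/-- **Stability of exhaustive p-Anchors.** If `A*` is selected by exhaustive
`p`-Anchors with tolerance `ε`, `p (A*) ≥ 1 - ε/4`, every other anchor of `𝒜₂^p(ε)` has
`p`-value at most `1 - 3ε/4`, and `δ := sup_{A ∈ 𝒜} |p A - q A| < ε/4`, then exhaustive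
`q`-Anchors with tolerance `ε - δ` selects exactly `A*`. -/
theorem statement_1 {α : Type*} [DecidableEq α]
    (ε : ℝ) (hε : 0 < ε) (𝒜 : Finset α) (h𝒜 : 𝒜.Nonempty)
    (len : α → ℕ) (p q : α → ℝ)
    (hA1 : (anchorsA1 𝒜 p ε).Nonempty)
    (Astar : α) (hAstar : Astar ∈ anchorsA3 𝒜 len p ε)
    (h1 : 1 - ε/4 ≤ p Astar)
    (h2 : ∀ A ∈ anchorsA2 𝒜 len p ε, A ≠ Astar → p A ≤ 1 - 3*ε/4)
    (δ : ℝ) (hδ : δ = 𝒜.sup' h𝒜 fun A => |p A - q A|)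
    (hδε : δ < ε/4) :
    anchorsA3 𝒜 len q (ε - δ) = {Astar} := by
  have hclose : ∀ A ∈ 𝒜, |p A - q A| ≤ δ := fun A hA =>
    hδ ▸ Finset.le_sup' (fun A => |p A - q A|) hA
  simp only [anchorsA3, Finset.mem_filter] at hAstar
  obtain ⟨hstar₂, -⟩ := hAstar
  have hsub : ∀ A ∈ anchorsA1 𝒜 q (ε - δ), A ∈ anchorsA1 𝒜 p ε := by
    intro A hA
    simp only [anchorsA1, Finset.mem_filter] at hA ⊢
    have := abs_le.mp (hclose A hA.1)
    exact ⟨hA.1, by linarith⟩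
  have hstar₁ := hstar₂
  simp only [anchorsA2, Finset.mem_filter] at hstar₁
  obtain ⟨hstar₁, hmin⟩ := hstar₁
  have hstar_mem : Astar ∈ 𝒜 := (Finset.mem_filter.mp hstar₁).1
  have hstar_close := abs_le.mp (hclose Astar hstar_mem)
  have hstarq₁ : Astar ∈ anchorsA1 𝒜 q (ε - δ) := by
    simp only [anchorsA1, Finset.mem_filter]
    exact ⟨hstar_mem, by linarith⟩
  have hstarq₂ : Astar ∈ anchorsA2 𝒜 len q (ε - δ) := by
    simp only [anchorsA2, Finset.mem_filter]
    exact ⟨hstarq₁, fun B hB => hmin B (hsub B hB)⟩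
  have hlt : ∀ A ∈ anchorsA2 𝒜 len q (ε - δ), A ≠ Astar → q A < q Astar := by
    intro A hA hne
    simp only [anchorsA2, Finset.mem_filter] at hA
    have hA₂ : A ∈ anchorsA2 𝒜 len p ε := by
      simp only [anchorsA2, Finset.mem_filter]
      exact ⟨hsub A hA.1, fun B hB => (hA.2 Astar hstarq₁).trans (hmin B hB)⟩
    have hA_close := abs_le.mp (hclose A (Finset.mem_filter.mp hA.1).1)
    linarith [h2 A hA₂ hne]
  ext A
  simp only [anchorsA3, Finset.mem_filter, Finset.mem_singleton]
  constructor
  · rintro ⟨hA, hmax⟩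
    by_contra hne
    exact (hlt A hA hne).not_ge (hmax Astar hstarq₂)
  · rintro rfl
    refine ⟨hstarq₂, fun B hB => ?_⟩
    by_cases hne : B = A
    · rw [hne]
    · exact (hlt B hB hne).le
end

section
/- Let λ₀ ∈ ℝ and λ ∈ ℝ^d with λ_j v_j ≠ 0 for all j ∈ {1, …, d}, and set b := Σ_{j=1}^d m_j. Consider an anchor a with length |a| = Σ_j a_j ≤ b/2, and define the precision Prec(a) := P(λ₀ + Σ_{j=1}^d λ_j v_j M_j > 0). Then |Prec(a) − Φ̄(L(a))| ≤ C · (max_j λ_j² v_j² / min_j λ_j² v_j²)^{3/2} · (max_j m_j / min_j m_j)^{3/2} · d^{−1/2}, where C = 16 √2 C₀ / √π ≈ 7.15 and C₀ = 0.56 is the Berry–Esseen constant of Shevtsova for non-identically distributed summands. -/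
open MeasureTheory ProbabilityTheory

/-- The distribution of a `Binomial(n, 1/2)` random variable, as a measure on `ℕ`. -/
noncomputable def binomHalf (n : ℕ) : Measure ℕ :=
  ((PMF.binomial (1/2) (by norm_num) n).map Fin.val).toMeasure

instance (n : ℕ) : IsProbabilityMeasure (binomHalf n) := by
  unfold binomHalf; infer_instance

/-- The anchor-sampling model: given multiplicities `m` and an anchor `a`, the random
multiplicities are `M j = a j + B j` where the `B j ~ Binomial(m j - a j, 1/2)` are
independent.  `anchorMeasure m a` is the joint law of `(B j)_j` on `Fin d → ℕ`. -/
noncomputable def anchorMeasure {d : ℕ} (m a : Fin d → ℕ) : Measure (Fin d → ℕ) :=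
  Measure.pi fun j => binomHalf (m j - a j)

instance {d : ℕ} (m a : Fin d → ℕ) : IsProbabilityMeasure (anchorMeasure m a) := by
  unfold anchorMeasure; infer_instance

/-- The cumulative distribution function `Φ` of the standard Gaussian `N(0,1)`. -/
noncomputable def stdGaussCDF (t : ℝ) : ℝ :=
  (ProbabilityTheory.gaussianReal 0 1 (Set.Iic t)).toReal

/-- The quantity `L(a)` appearing in the approximation of the precision of a linear
classifier:
`L(a) = (-λ₀ - (1/2) Σ_j λ_j v_j (m_j + a_j)) / sqrt((1/4) Σ_j λ_j² v_j² (m_j - a_j))`. -/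
noncomputable def Lfun {d : ℕ} (lam0 : ℝ) (lam v : Fin d → ℝ) (m a : Fin d → ℕ) : ℝ :=
  (-lam0 - (1/2) * ∑ j, lam j * v j * ((m j : ℝ) + (a j : ℝ))) /
    Real.sqrt ((1/4) * ∑ j, (lam j)^2 * (v j)^2 * ((m j : ℝ) - (a j : ℝ)))

open Set Filter Topology

local notation "φ" => gaussianPDFReal 0 1

lemma stdGaussCDF_eq_cdf (x : ℝ) : stdGaussCDF x = cdf (gaussianReal 0 1) x := by
  rw [cdf_eq_real]; rfl

lemma stdGaussCDF_nonneg (x : ℝ) : 0 ≤ stdGaussCDF x := ENNReal.toReal_nonneg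

lemma stdGaussCDF_le_one (x : ℝ) : stdGaussCDF x ≤ 1 := by
  rw [stdGaussCDF_eq_cdf]; exact cdf_le_one _ _

lemma stdGaussCDF_mono : Monotone stdGaussCDF := by
  intro x y h
  simp only [stdGaussCDF_eq_cdf]
  exact monotone_cdf _ h

lemma tendsto_stdGaussCDF_atTop : Tendsto stdGaussCDF atTop (𝓝 1) :=
  (tendsto_cdf_atTop (gaussianReal 0 1)).congr fun x => (stdGaussCDF_eq_cdf x).symm

lemma stdGaussCDF_neg (x : ℝ) : stdGaussCDF (-x) = 1 - stdGaussCDF x := by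
  have : NullSingletonClass (gaussianReal 0 1) := nullSingletonClass_gaussianReal one_ne_zero
  have h1 : gaussianReal 0 1 (Iic (-x)) = gaussianReal 0 1 (Ici x) := by
    conv_lhs => rw [show gaussianReal 0 1 = (gaussianReal 0 1).map (fun x => -x) by
      rw [gaussianReal_map_neg, neg_zero]]
    rw [Measure.map_apply measurable_neg measurableSet_Iic]
    congr 1
    ext y
    simp
  have h2 : gaussianReal 0 1 (Ici x) = gaussianReal 0 1 (Iic x)ᶜ := by
    rw [compl_Iic]; exact (measure_congr Ioi_ae_eq_Ici).symm
  unfold stdGaussCDF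
  rw [h1, h2]
  exact probReal_compl_eq_one_sub measurableSet_Iic

lemma continuous_stdGaussPDF : Continuous φ := by
  rw [gaussianPDFReal_def]; fun_prop

lemma hasDerivAt_stdGaussCDF (x : ℝ) : HasDerivAt stdGaussCDF (φ x) x := by
  have key : stdGaussCDF = fun x => stdGaussCDF 0 + ∫ t in (0 : ℝ)..x, φ t := by
    funext y
    have h (y : ℝ) : stdGaussCDF y = ∫ t in Iic y, φ t := by
      unfold stdGaussCDF
      rw [gaussianReal_apply_eq_integral _ one_ne_zero, ENNReal.toReal_ofReal]
      exact integral_nonneg fun _ => gaussianPDFReal_nonneg _ _ _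
    rw [h, h, ← intervalIntegral.integral_Iic_sub_Iic
      (integrable_gaussianPDFReal 0 1).integrableOn (integrable_gaussianPDFReal 0 1).integrableOn]
    ring
  rw [key]
  exact ((continuous_stdGaussPDF.integral_hasStrictDerivAt 0 x).hasDerivAt).const_add _

lemma stdGaussPDF_eq (x : ℝ) : φ x = (√(2 * Real.pi))⁻¹ * Real.exp (-x ^ 2 / 2) := by
  simp [gaussianPDFReal]

lemma hasDerivAt_stdGaussPDF (x : ℝ) : HasDerivAt φ (-x * φ x) x := by
  have : φ = fun x => (√(2 * Real.pi))⁻¹ * Real.exp (-x ^ 2 / 2) := funext stdGaussPDF_eq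
  rw [this]
  have h := ((((hasDerivAt_id x).pow 2).neg.div_const 2).exp).const_mul (√(2 * Real.pi))⁻¹
  convert! h using 1
  simp
  ring

lemma stdGaussPDF_pos (x : ℝ) : 0 < φ x := gaussianPDFReal_pos _ _ _ one_ne_zero

lemma stdGaussPDF_neg (x : ℝ) : φ (-x) = φ x := by simp [stdGaussPDF_eq]

lemma inv_sqrt_two_pi_le : (√(2 * Real.pi))⁻¹ ≤ 1 / 2 := by
  have : 2 ≤ √(2 * Real.pi) := Real.le_sqrt_of_sq_le (by nlinarith [Real.pi_gt_three])
  rw [one_div]; gcongr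

lemma stdGaussPDF_le (x : ℝ) : φ x ≤ 1 / 2 := by
  rw [stdGaussPDF_eq]
  have : Real.exp (-x ^ 2 / 2) ≤ 1 := Real.exp_le_one_iff.2 (by nlinarith [sq_nonneg x])
  nlinarith [inv_sqrt_two_pi_le, Real.exp_pos (-x ^ 2 / 2), Real.sqrt_nonneg (2 * Real.pi)]

lemma stdGaussPDF_ge {x : ℝ} (h0 : 0 ≤ x) (h1 : x ≤ 1 / 2) : 1 / 4 ≤ φ x := by
  rw [stdGaussPDF_eq]
  have h2 : √(2 * Real.pi) ≤ 2.6 := by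
    rw [Real.sqrt_le_left (by norm_num)]; nlinarith [Real.pi_lt_d2]
  have h3 : (2.6 : ℝ)⁻¹ ≤ (√(2 * Real.pi))⁻¹ := by
    have := Real.pi_pos
    gcongr
  have h4 : 7 / 8 ≤ Real.exp (-x ^ 2 / 2) := by
    nlinarith [Real.add_one_le_exp (-x ^ 2 / 2)]
  nlinarith

lemma stdGaussCDF_sub_le {x y : ℝ} (h : x ≤ y) :
    stdGaussCDF y - stdGaussCDF x ≤ 1 / 2 * (y - x) := by
  have hd : Differentiable ℝ stdGaussCDF := fun t => (hasDerivAt_stdGaussCDF t).differentiableAt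
  refine image_sub_le_mul_sub_of_deriv_le hd (fun t => ?_) h
  rw [(hasDerivAt_stdGaussCDF t).deriv]
  exact stdGaussPDF_le t

/-- The Mills ratio bound for the Gaussian upper tail. -/
lemma mul_one_sub_stdGaussCDF_le {x : ℝ} (hx : 0 < x) : x * (1 - stdGaussCDF x) ≤ φ x := by
  have hanti : AntitoneOn (fun t => φ t / t - (1 - stdGaussCDF t)) (Ioi 0) := by
    have hder (t : ℝ) (ht : t ∈ Ioi (0 : ℝ)) :
        HasDerivAt (fun t => φ t / t - (1 - stdGaussCDF t)) (-(φ t / t ^ 2)) t := by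
      have ht' : t ≠ 0 := ne_of_gt ht
      convert! ((hasDerivAt_stdGaussPDF t).div (hasDerivAt_id t) ht').sub
        ((hasDerivAt_stdGaussCDF t).const_sub 1) using 1
      simp only [id]
      field_simp
      ring
    refine antitoneOn_of_deriv_nonpos (convex_Ioi 0)
      (fun t ht => (hder t ht).continuousAt.continuousWithinAt) ?_ ?_
    · intro t ht
      rw [interior_Ioi] at ht
      exact (hder t ht).differentiableAt.differentiableWithinAt
    · intro t ht
      rw [interior_Ioi] at ht
      rw [(hder t ht).deriv, neg_nonpos]
      exact div_nonneg (stdGaussPDF_pos t).le (sq_nonneg t)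
  have hlim : Tendsto (fun t => φ t / t - (1 - stdGaussCDF t)) atTop (𝓝 (0 - (1 - 1))) := by
    refine Tendsto.sub ?_ (tendsto_stdGaussCDF_atTop.const_sub 1)
    refine squeeze_zero' (g := fun t : ℝ => (1 / 2) / t) ?_ ?_
      (tendsto_const_nhds.div_atTop tendsto_id)
    · filter_upwards [eventually_gt_atTop 0] with t ht
      exact div_nonneg (stdGaussPDF_pos t).le ht.le
    · filter_upwards [eventually_gt_atTop 0] with t ht
      have := stdGaussPDF_le t
      gcongr
  have hge : (0 - (1 - 1) : ℝ) ≤ φ x / x - (1 - stdGaussCDF x) := by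
    refine le_of_tendsto hlim ?_
    filter_upwards [eventually_ge_atTop x] with t ht
    exact hanti hx (hx.trans_le ht) ht
  have h1 : 1 - stdGaussCDF x ≤ φ x / x := by linarith
  rw [le_div_iff₀ hx] at h1
  linarith

lemma one_sub_stdGaussCDF_le {x : ℝ} (hx : 0 ≤ x) : 1 - stdGaussCDF x ≤ 2 * φ x := by
  rcases le_total x (1 / 2) with h | h
  · have h0 := stdGaussCDF_neg 0
    have := stdGaussCDF_mono hx
    have := stdGaussPDF_ge hx h
    rw [neg_zero] at h0
    linarith
  · have h1 := mul_one_sub_stdGaussCDF_le (x := x) (by linarith)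
    nlinarith [stdGaussCDF_le_one x]

/-- The solution of the Stein equation of the half line `Iic z`. -/
noncomputable def steinSol (z x : ℝ) : ℝ :=
  (stdGaussCDF (min x z) - stdGaussCDF z * stdGaussCDF x) / φ x

lemma steinSol_nonneg (z x : ℝ) : 0 ≤ steinSol z x := by
  refine div_nonneg ?_ (stdGaussPDF_pos x).le
  rcases le_total x z with h | h
  · rw [min_eq_left h]
    nlinarith [stdGaussCDF_nonneg x, stdGaussCDF_le_one z]
  · rw [min_eq_right h]
    nlinarith [stdGaussCDF_nonneg z, stdGaussCDF_le_one x]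

lemma steinSol_num_le_cdf (z x : ℝ) :
    stdGaussCDF (min x z) - stdGaussCDF z * stdGaussCDF x ≤ stdGaussCDF x := by
  have := stdGaussCDF_mono (min_le_left x z)
  nlinarith [stdGaussCDF_nonneg z, stdGaussCDF_nonneg x]

lemma steinSol_num_le_one_sub (z x : ℝ) :
    stdGaussCDF (min x z) - stdGaussCDF z * stdGaussCDF x ≤ 1 - stdGaussCDF x := by
  have := stdGaussCDF_mono (min_le_right x z)
  nlinarith [stdGaussCDF_le_one z, stdGaussCDF_le_one x]

lemma steinSol_le_two (z x : ℝ) : steinSol z x ≤ 2 := by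
  rw [steinSol, div_le_iff₀ (stdGaussPDF_pos x)]
  rcases le_total 0 x with h | h
  · exact (steinSol_num_le_one_sub z x).trans (one_sub_stdGaussCDF_le h)
  · have := one_sub_stdGaussCDF_le (neg_nonneg.2 h)
    rw [stdGaussCDF_neg, stdGaussPDF_neg] at this
    linarith [steinSol_num_le_cdf z x]

lemma abs_mul_steinSol_le_one (z x : ℝ) : |x| * steinSol z x ≤ 1 := by
  rw [steinSol, ← mul_div_assoc, div_le_iff₀ (stdGaussPDF_pos x), one_mul]
  rcases lt_trichotomy x 0 with h | h | h
  · have := mul_one_sub_stdGaussCDF_le (neg_pos.2 h)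
    rw [stdGaussCDF_neg, stdGaussPDF_neg] at this
    rw [abs_of_neg h]
    nlinarith [steinSol_num_le_cdf z x]
  · simp [h, (stdGaussPDF_pos 0).le]
  · have := mul_one_sub_stdGaussCDF_le h
    rw [abs_of_pos h]
    nlinarith [steinSol_num_le_one_sub z x]

lemma continuous_stdGaussCDF : Continuous stdGaussCDF :=
  continuous_iff_continuousAt.2 fun x => (hasDerivAt_stdGaussCDF x).continuousAt

lemma continuous_steinSol (z : ℝ) : Continuous (steinSol z) := by
  have := continuous_stdGaussCDF
  exact Continuous.div (by fun_prop) continuous_stdGaussPDF fun x => (stdGaussPDF_pos x).ne'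

/-- The right derivative of `steinSol z`, given by the Stein equation. -/
noncomputable def steinDeriv (z x : ℝ) : ℝ :=
  x * steinSol z x + (if x < z then 1 else 0) - stdGaussCDF z

lemma hasDerivWithinAt_steinSol (z x : ℝ) :
    HasDerivWithinAt (steinSol z) (steinDeriv z x) (Ici x) x := by
  have hφ := (stdGaussPDF_pos x).ne'
  have h1 : HasDerivWithinAt (fun t => stdGaussCDF (min t z)) (if x < z then φ x else 0)
      (Ici x) x := by
    split_ifs with h
    · refine ((hasDerivAt_stdGaussCDF x).congr_of_eventuallyEq ?_).hasDerivWithinAt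
      filter_upwards [eventually_lt_nhds h] with t ht
      rw [min_eq_left ht.le]
    · refine (hasDerivWithinAt_const x (Ici x) (stdGaussCDF z)).congr (fun t ht => ?_) ?_
      · rw [min_eq_right ((not_lt.1 h).trans ht)]
      · rw [min_eq_right (not_lt.1 h)]
  have h2 := (h1.sub ((hasDerivAt_stdGaussCDF x).const_mul (stdGaussCDF z)).hasDerivWithinAt).div
    (hasDerivAt_stdGaussPDF x).hasDerivWithinAt hφ
  convert! h2 using 1
  unfold steinDeriv steinSol
  simp only [Pi.sub_apply]
  split_ifs <;> field_simp <;> ring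

lemma abs_steinDeriv_le (z x : ℝ) : |steinDeriv z x| ≤ 2 := by
  have h1 := abs_mul_steinSol_le_one z x
  have h2 : |x * steinSol z x| ≤ 1 := by rwa [abs_mul, abs_of_nonneg (steinSol_nonneg z x)]
  rw [abs_le] at h2 ⊢
  have := stdGaussCDF_nonneg z
  have := stdGaussCDF_le_one z
  unfold steinDeriv
  split_ifs <;> constructor <;> linarith

lemma steinSol_sub_le_of_le {z a b K : ℝ} (hab : a ≤ b)
    (h : ∀ t ∈ Icc a b, steinDeriv z t ≤ K) : steinSol z b - steinSol z a ≤ K * (b - a) := by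
  have := image_le_of_deriv_right_le_deriv_boundary (f := steinSol z) (f' := steinDeriv z)
    (B := fun t => steinSol z a + K * (t - a)) (B' := fun _ => K) (a := a) (b := b)
    (continuous_steinSol z).continuousOn (fun t _ => hasDerivWithinAt_steinSol z t)
    (by simp) (by fun_prop)
    (fun t _ => by
      simpa using ((((hasDerivAt_id t).sub_const a).const_mul K).const_add
        (steinSol z a)).hasDerivWithinAt)
    (fun t ht => h t (Ico_subset_Icc_self ht)) (right_mem_Icc.2 hab)
  linarith

lemma le_steinSol_sub_of_le {z a b K : ℝ} (hab : a ≤ b)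
    (h : ∀ t ∈ Icc a b, K ≤ steinDeriv z t) : K * (b - a) ≤ steinSol z b - steinSol z a := by
  have := image_le_of_deriv_right_le_deriv_boundary (f' := fun _ => K) (B' := steinDeriv z)
    (f := fun t => steinSol z a + K * (t - a)) (B := steinSol z) (a := a) (b := b)
    (by fun_prop)
    (fun t _ => by
      simpa using ((((hasDerivAt_id t).sub_const a).const_mul K).const_add
        (steinSol z a)).hasDerivWithinAt)
    (by simp) (continuous_steinSol z).continuousOn (fun t _ => hasDerivWithinAt_steinSol z t)
    (fun t ht => h t (Ico_subset_Icc_self ht)) (right_mem_Icc.2 hab)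
  linarith

lemma abs_steinSol_sub_le (z x y : ℝ) : |steinSol z x - steinSol z y| ≤ 2 * |x - y| := by
  wlog hxy : y ≤ x generalizing x y
  · rw [abs_sub_comm, abs_sub_comm x]
    exact this y x (le_of_not_ge hxy)
  rw [abs_of_nonneg (sub_nonneg.2 hxy), abs_le]
  have h1 := steinSol_sub_le_of_le (z := z) hxy fun t _ => (abs_le.1 (abs_steinDeriv_le z t)).2
  have h2 := le_steinSol_sub_of_le (z := z) hxy fun t _ => (abs_le.1 (abs_steinDeriv_le z t)).1
  constructor <;> linarith

lemma abs_mul_steinSol_sub_le (z w t : ℝ) :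
    |t * steinSol z t - w * steinSol z w| ≤ (2 * |w| + 2) * |t - w| := by
  have e : t * steinSol z t - w * steinSol z w
      = (t - w) * steinSol z t + w * (steinSol z t - steinSol z w) := by ring
  have h1 : |steinSol z t| ≤ 2 := by
    rw [abs_of_nonneg (steinSol_nonneg z t)]; exact steinSol_le_two z t
  rw [e]
  refine (abs_add_le _ _).trans ?_
  rw [abs_mul, abs_mul]
  nlinarith [abs_steinSol_sub_le z t w, abs_nonneg w, abs_nonneg (t - w)]

/-- Multiplied by the increment `δ`, a bound on the derivative along a segment of either
orientation bounds the increment of the Stein solution from above. -/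
lemma mul_steinSol_sub_le {z w δ β : ℝ} (hδ : |δ| ≤ β) :
    δ * (steinSol z w - steinSol z (w - δ)) ≤ δ ^ 2 * (w * steinSol z w + (2 * |w| + 2) * β
      + (if w < z + β then 1 else 0) - stdGaussCDF z) := by
  have hb (t : ℝ) (ht : |t - w| ≤ |δ|) : steinDeriv z t ≤ w * steinSol z w + (2 * |w| + 2) * β
      + (if w < z + β then 1 else 0) - stdGaussCDF z := by
    have h1 := (abs_le.1 (abs_mul_steinSol_sub_le z w t)).2
    have h2 : (2 * |w| + 2) * |t - w| ≤ (2 * |w| + 2) * β := by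
      have := ht.trans hδ
      gcongr
    have h3 : (if t < z then 1 else 0 : ℝ) ≤ if w < z + β then 1 else 0 := by
      have := (abs_le.1 (ht.trans hδ)).1
      split_ifs <;> linarith
    unfold steinDeriv
    linarith
  rcases le_total 0 δ with h | h
  · have := steinSol_sub_le_of_le (z := z) (a := w - δ) (b := w) (by linarith) fun t ht => hb t (by
      rw [abs_of_nonneg h, abs_le]; constructor <;> linarith [ht.1, ht.2])
    nlinarith
  · have := steinSol_sub_le_of_le (z := z) (a := w) (b := w - δ) (by linarith) fun t ht => hb t (by
      rw [abs_of_nonpos h, abs_le]; constructor <;> linarith [ht.1, ht.2])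
    nlinarith

lemma le_mul_steinSol_sub {z w δ β : ℝ} (hδ : |δ| ≤ β) :
    δ ^ 2 * (w * steinSol z w - (2 * |w| + 2) * β
      + (if w < z - β then 1 else 0) - stdGaussCDF z) ≤
      δ * (steinSol z w - steinSol z (w - δ)) := by
  have hb (t : ℝ) (ht : |t - w| ≤ |δ|) : w * steinSol z w - (2 * |w| + 2) * β
      + (if w < z - β then 1 else 0) - stdGaussCDF z ≤ steinDeriv z t := by
    have h1 := (abs_le.1 (abs_mul_steinSol_sub_le z w t)).1
    have h2 : (2 * |w| + 2) * |t - w| ≤ (2 * |w| + 2) * β := by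
      have := ht.trans hδ
      gcongr
    have h3 : (if w < z - β then 1 else 0 : ℝ) ≤ if t < z then 1 else 0 := by
      have := (abs_le.1 (ht.trans hδ)).2
      split_ifs <;> linarith
    unfold steinDeriv
    linarith
  rcases le_total 0 δ with h | h
  · have := le_steinSol_sub_of_le (z := z) (a := w - δ) (b := w) (by linarith) fun t ht => hb t (by
      rw [abs_of_nonneg h, abs_le]; constructor <;> linarith [ht.1, ht.2])
    nlinarith
  · have := le_steinSol_sub_of_le (z := z) (a := w) (b := w - δ) (by linarith) fun t ht => hb t (by
      rw [abs_of_nonpos h, abs_le]; constructor <;> linarith [ht.1, ht.2])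
    nlinarith

section SignSums

variable {Ω ι : Type*}

/-- A family of signs on a finite set, each of which can be flipped by a permutation that
preserves all the others: independent Rademacher variables for the uniform distribution. -/
structure IsFlipFamily (s : ι → Ω → ℝ) (τ : ι → Equiv.Perm Ω) : Prop where
  sq_eq_one : ∀ i ω, s i ω ^ 2 = 1
  flip_self : ∀ i ω, s i (τ i ω) = -s i ω
  flip_of_ne : ∀ i k ω, k ≠ i → s k (τ i ω) = s k ω

variable {s : ι → Ω → ℝ} {τ : ι → Equiv.Perm Ω}

lemma IsFlipFamily.abs_eq_one (h : IsFlipFamily s τ) (i : ι) (ω : Ω) : |s i ω| = 1 := by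
  rw [← Real.sqrt_sq_eq_abs, h.sq_eq_one, Real.sqrt_one]

variable [Fintype Ω] [Fintype ι] (c : ι → ℝ)

lemma IsFlipFamily.sum_mul_comp_eq_zero (h : IsFlipFamily s τ) (i : ι) (g : ℝ → ℝ) :
    ∑ ω, s i ω * g ((∑ k, c k * s k ω) - c i * s i ω) = 0 := by
  classical
  have hoff (ω : Ω) : (∑ k, c k * s k (τ i ω)) - c i * s i (τ i ω)
      = (∑ k, c k * s k ω) - c i * s i ω := by
    rw [← Finset.sum_erase_eq_sub (Finset.mem_univ i), ← Finset.sum_erase_eq_sub (Finset.mem_univ i)]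
    exact Finset.sum_congr rfl fun k hk => by rw [h.flip_of_ne i k ω (Finset.ne_of_mem_erase hk)]
  have key := Equiv.sum_comp (τ i) fun ω => s i ω * g ((∑ k, c k * s k ω) - c i * s i ω)
  simp only [hoff] at key
  simp only [h.flip_self, neg_mul, Finset.sum_neg_distrib] at key
  linarith

lemma IsFlipFamily.sum_mul_eq (h : IsFlipFamily s τ) (f : ℝ → ℝ) :
    ∑ ω, (∑ k, c k * s k ω) * f (∑ k, c k * s k ω)
      = ∑ ω, ∑ i, c i * s i ω * (f (∑ k, c k * s k ω)
          - f ((∑ k, c k * s k ω) - c i * s i ω)) := by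
  have h0 : ∑ ω, ∑ i, c i * s i ω * f ((∑ k, c k * s k ω) - c i * s i ω) = 0 := by
    rw [Finset.sum_comm]
    refine Finset.sum_eq_zero fun i _ => ?_
    simp only [mul_assoc]
    rw [← Finset.mul_sum, h.sum_mul_comp_eq_zero c i f, mul_zero]
  simp only [mul_sub, Finset.sum_sub_distrib, h0, sub_zero, Finset.sum_mul]

lemma IsFlipFamily.sum_sq (h : IsFlipFamily s τ) :
    ∑ ω, (∑ k, c k * s k ω) ^ 2 = Fintype.card Ω * ∑ i, c i ^ 2 := by
  have := h.sum_mul_eq c id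
  simp only [id, sub_sub_cancel, ← pow_two, mul_pow, h.sq_eq_one, mul_one] at this
  rw [this, Finset.sum_const, Finset.card_univ, nsmul_eq_mul]

variable {c}

lemma IsFlipFamily.sum_abs_le (h : IsFlipFamily s τ) (hc : ∑ i, c i ^ 2 = 1) :
    ∑ ω, |∑ k, c k * s k ω| ≤ Fintype.card Ω := by
  have h2 := h.sum_sq c
  rw [hc, mul_one] at h2
  have h1 : ∑ ω, |∑ k, c k * s k ω| ≤ ∑ ω, ((∑ k, c k * s k ω) ^ 2 + 1) / 2 :=
    Finset.sum_le_sum fun ω _ => by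
      rw [← sq_abs (∑ k, c k * s k ω)]
      nlinarith [sq_nonneg (|∑ k, c k * s k ω| - 1)]
  rw [← Finset.sum_div, Finset.sum_add_distrib, h2] at h1
  simp only [Finset.sum_const, Finset.card_univ, nsmul_eq_mul, mul_one] at h1
  linarith

variable {β : ℝ}

lemma IsFlipFamily.card_mul_cdf_le (h : IsFlipFamily s τ) (hc : ∑ i, c i ^ 2 = 1)
    (hβ0 : 0 ≤ β) (hβ : ∀ i, |c i| ≤ β) (z : ℝ) :
    Fintype.card Ω * stdGaussCDF z ≤
      (∑ ω, if ∑ k, c k * s k ω < z + β then 1 else 0) + 4 * β * Fintype.card Ω := by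
  have hb (i : ι) (ω : Ω) : |c i * s i ω| ≤ β := by
    rw [abs_mul, h.abs_eq_one i ω, mul_one]; exact hβ i
  have h1 := h.sum_mul_eq c (steinSol z)
  have h2 : ∑ ω, ∑ i, c i * s i ω * (steinSol z (∑ k, c k * s k ω)
          - steinSol z ((∑ k, c k * s k ω) - c i * s i ω)) ≤
      ∑ ω, ((∑ k, c k * s k ω) * steinSol z (∑ k, c k * s k ω) + (2 * |∑ k, c k * s k ω| + 2) * β
      + (if ∑ k, c k * s k ω < z + β then 1 else 0) - stdGaussCDF z) := by
    refine Finset.sum_le_sum fun ω _ => ?_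
    refine (Finset.sum_le_sum fun i _ => mul_steinSol_sub_le (hb i ω)).trans_eq ?_
    simp only [mul_pow, h.sq_eq_one, mul_one]
    rw [← Finset.sum_mul, hc, one_mul]
  have h3 := mul_le_mul_of_nonneg_right (h.sum_abs_le hc) hβ0
  simp only [Finset.sum_sub_distrib, Finset.sum_add_distrib, ← Finset.sum_mul, ← Finset.mul_sum,
    Finset.sum_const, Finset.card_univ, nsmul_eq_mul] at h2
  linarith

lemma IsFlipFamily.le_card_mul_cdf (h : IsFlipFamily s τ) (hc : ∑ i, c i ^ 2 = 1)
    (hβ0 : 0 ≤ β) (hβ : ∀ i, |c i| ≤ β) (z : ℝ) :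
    (∑ ω, if ∑ k, c k * s k ω < z - β then 1 else 0) - 4 * β * Fintype.card Ω ≤
      Fintype.card Ω * stdGaussCDF z := by
  have hb (i : ι) (ω : Ω) : |c i * s i ω| ≤ β := by
    rw [abs_mul, h.abs_eq_one i ω, mul_one]; exact hβ i
  have h1 := h.sum_mul_eq c (steinSol z)
  have h2 : ∑ ω, ((∑ k, c k * s k ω) * steinSol z (∑ k, c k * s k ω)
      - (2 * |∑ k, c k * s k ω| + 2) * β
      + (if ∑ k, c k * s k ω < z - β then 1 else 0) - stdGaussCDF z) ≤
      ∑ ω, ∑ i, c i * s i ω * (steinSol z (∑ k, c k * s k ω)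
          - steinSol z ((∑ k, c k * s k ω) - c i * s i ω)) := by
    refine Finset.sum_le_sum fun ω _ => ?_
    refine le_of_eq_of_le ?_ (Finset.sum_le_sum fun i _ => le_mul_steinSol_sub (hb i ω))
    simp only [mul_pow, h.sq_eq_one, mul_one]
    rw [← Finset.sum_mul, hc, one_mul]
  have h3 := mul_le_mul_of_nonneg_right (h.sum_abs_le hc) hβ0
  simp only [Finset.sum_sub_distrib, Finset.sum_add_distrib, ← Finset.sum_mul, ← Finset.mul_sum,
    Finset.sum_const, Finset.card_univ, nsmul_eq_mul] at h2
  linarith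

/-- A Berry–Esseen bound for weighted sums of independent signs. -/
lemma IsFlipFamily.abs_card_sub_cdf_le [Nonempty Ω] (h : IsFlipFamily s τ)
    (hc : ∑ i, c i ^ 2 = 1) (hβ0 : 0 < β) (hβ : ∀ i, |c i| ≤ β) (x : ℝ) :
    |(Finset.card {ω | ∑ k, c k * s k ω ≤ x} : ℝ) / Fintype.card Ω - stdGaussCDF x| ≤ 5 * β := by
  have hN : (0 : ℝ) < Fintype.card Ω := by exact_mod_cast Fintype.card_pos
  have hle : (Finset.card {ω | ∑ k, c k * s k ω ≤ x} : ℝ) ≤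
      ∑ ω, if ∑ k, c k * s k ω < x + 2 * β - β then 1 else 0 := by
    rw [Finset.card_filter]
    push_cast
    refine Finset.sum_le_sum fun ω _ => ?_
    split_ifs <;> linarith
  have hge : (∑ ω, if ∑ k, c k * s k ω < x - β + β then 1 else 0) ≤
      (Finset.card {ω | ∑ k, c k * s k ω ≤ x} : ℝ) := by
    rw [Finset.card_filter]
    push_cast
    refine Finset.sum_le_sum fun ω _ => ?_
    split_ifs <;> linarith
  have h1 := h.le_card_mul_cdf hc hβ0.le hβ (x + 2 * β)
  have h2 := h.card_mul_cdf_le hc hβ0.le hβ (x - β)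
  have h3 := stdGaussCDF_sub_le (show x ≤ x + 2 * β by linarith)
  have h4 := stdGaussCDF_sub_le (show x - β ≤ x by linarith)
  rw [abs_le]
  constructor
  · rw [neg_le_sub_iff_le_add, ← sub_le_iff_le_add, le_div_iff₀ hN]
    nlinarith
  · rw [sub_le_iff_le_add, div_le_iff₀ hN]
    nlinarith

end SignSums

lemma binomHalf_eq_map (n : ℕ) :
    binomHalf n = (PMF.uniformOfFintype (Finset (Fin n))).toMeasure.map Finset.card := by
  classical
  refine Measure.ext_of_singleton fun k => ?_
  rw [Measure.map_apply (measurable_of_finite _) (measurableSet_singleton k),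
    PMF.toMeasure_uniformOfFintype_apply _ (Set.toFinite _).measurableSet, binomHalf,
    PMF.toMeasure_apply_singleton _ _ (measurableSet_singleton k), PMF.map_apply]
  have hcard : Fintype.card (Finset.card ⁻¹' {k} : Set (Finset (Fin n))) = n.choose k := by
    rw [Fintype.card_of_subtype (Finset.powersetCard k Finset.univ) (by simp)]
    simp
  rw [hcard, tsum_fintype, Fintype.card_finset, Fintype.card_fin]
  rcases Nat.lt_or_ge k (n + 1) with hk | hk
  · have h2 : (1 - 1 / 2 : NNReal) = 1 / 2 := by
      ext; rw [NNReal.coe_sub (by norm_num)]; norm_num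
    have h3 : k + (n - k) = n := by omega
    rw [Finset.sum_eq_single (⟨k, hk⟩ : Fin (n + 1)), if_pos rfl]
    · simp only [PMF.binomial, PMF.ofFintype_apply, h2, ← pow_add, Fin.val_last, h3]
      rw [div_eq_mul_inv, mul_comm]
      norm_num
      rw [div_eq_mul_inv, ENNReal.inv_pow]
    · intro b _ hb
      exact if_neg fun h => hb (Fin.ext h.symm)
    · simp
  · rw [Nat.choose_eq_zero_of_lt hk, Finset.sum_eq_zero]
    · simp
    · intro b _
      exact if_neg fun h => absurd b.isLt (by omega)

lemma anchorMeasure_toReal_eq {d : ℕ} (m a : Fin d → ℕ) (A : Set (Fin d → ℕ))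
    [DecidablePred fun ω : ∀ j, Finset (Fin (m j - a j)) => (fun j => (ω j).card) ∈ A] :
    (anchorMeasure m a A).toReal =
      (Finset.card {ω : ∀ j, Finset (Fin (m j - a j)) | (fun j => (ω j).card) ∈ A} : ℝ) /
        Fintype.card (∀ j, Finset (Fin (m j - a j))) := by
  have hmap : anchorMeasure m a =
      (Measure.pi fun j => (PMF.uniformOfFintype (Finset (Fin (m j - a j)))).toMeasure).map
        fun ω j => (ω j).card := by
    rw [Measure.pi_map_pi fun j => (measurable_of_finite _).aemeasurable]
    simp only [← binomHalf_eq_map]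
    rfl
  have hpre : (fun (ω : ∀ j, Finset (Fin (m j - a j))) j => (ω j).card) ⁻¹' A =
      (({ω : ∀ j, Finset (Fin (m j - a j)) | (fun j => (ω j).card) ∈ A} : Finset _) :
        Set (∀ j, Finset (Fin (m j - a j)))) := by
    ext; simp
  rw [hmap, Measure.map_apply (measurable_of_finite _) A.to_countable.measurableSet, hpre,
    ← sum_measure_singleton]
  simp only [Measure.pi_singleton, PMF.toMeasure_apply_singleton _ _ (measurableSet_singleton _),
    PMF.uniformOfFintype_apply, Finset.sum_const, nsmul_eq_mul, Fintype.card_pi]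
  simp [ENNReal.toReal_prod, div_eq_mul_inv]

section BlockSigns

variable {d : ℕ} {n : Fin d → ℕ}

/-- The sign attached to an element of one of the blocks: `1` if it is selected, else `-1`. -/
def blockSign (k : Σ j, Fin (n j)) (ω : ∀ j, Finset (Fin (n j))) : ℝ :=
  if k.2 ∈ ω k.1 then 1 else -1

/-- Toggle the selection of a single element. -/
def blockFlip (k : Σ j, Fin (n j)) : Equiv.Perm (∀ j, Finset (Fin (n j))) :=
  Function.Involutive.toPerm (fun ω => Function.update ω k.1 (symmDiff (ω k.1) {k.2})) fun ω => by
    simp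

lemma blockFlip_apply (k : Σ j, Fin (n j)) (ω : ∀ j, Finset (Fin (n j))) :
    blockFlip k ω = Function.update ω k.1 (symmDiff (ω k.1) {k.2}) := rfl

lemma isFlipFamily_blockSign : IsFlipFamily (blockSign (n := n)) blockFlip where
  sq_eq_one k ω := by unfold blockSign; split_ifs <;> norm_num
  flip_self k ω := by
    simp only [blockSign, blockFlip_apply, Function.update_self, Finset.mem_symmDiff,
      Finset.mem_singleton]
    by_cases h : k.2 ∈ ω k.1 <;> simp [h]
  flip_of_ne := by
    rintro ⟨j, i⟩ ⟨j', i'⟩ ω h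
    rcases eq_or_ne j' j with rfl | hj
    · have hi : i' ≠ i := fun e => h (by rw [e])
      simp [blockSign, blockFlip_apply, Finset.mem_symmDiff, hi]
    · have hω : blockFlip ⟨j, i⟩ ω j' = ω j' := Function.update_of_ne hj _ _
      simp [blockSign, hω]

lemma sum_blockSign (c : Fin d → ℝ) (ω : ∀ j, Finset (Fin (n j))) :
    ∑ k : Σ j, Fin (n j), c k.1 * blockSign k ω = ∑ j, c j * (2 * (ω j).card - n j) := by
  rw [Fintype.sum_sigma]
  refine Finset.sum_congr rfl fun j _ => ?_
  change ∑ i, c j * blockSign ⟨j, i⟩ ω = _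
  rw [← Finset.mul_sum]
  congr 1
  have (i : Fin (n j)) : blockSign ⟨j, i⟩ ω = 2 * (if i ∈ ω j then 1 else 0) - 1 := by
    unfold blockSign; split_ifs <;> norm_num
  simp only [this, Finset.sum_sub_distrib, ← Finset.mul_sum]
  simp

end BlockSigns

/-- A Berry–Esseen bound for the anchor-sampling model in terms of the largest normalized
coefficient. -/
lemma abs_anchorMeasure_sub_le {d : ℕ} (m a : Fin d → ℕ) (ham : ∀ j, a j ≤ m j)
    (v lam : Fin d → ℝ) (lam0 : ℝ) {β : ℝ} (hβ0 : 0 < β)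
    (hσ : 0 < (1 / 4) * ∑ j, (lam j) ^ 2 * (v j) ^ 2 * ((m j : ℝ) - (a j : ℝ)))
    (hβ : ∀ j, |lam j * v j| / 2 ≤
      β * √((1 / 4) * ∑ j, (lam j) ^ 2 * (v j) ^ 2 * ((m j : ℝ) - (a j : ℝ)))) :
    |(anchorMeasure m a {ω | 0 < lam0 + ∑ j, lam j * v j * ((a j + ω j : ℕ) : ℝ)}).toReal -
      (1 - stdGaussCDF (Lfun lam0 lam v m a))| ≤ 5 * β := by
  classical
  have hsub (j : Fin d) : ((m j - a j : ℕ) : ℝ) = m j - a j := Nat.cast_sub (ham j)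
  unfold Lfun
  set V := (1 / 4) * ∑ j, (lam j) ^ 2 * (v j) ^ 2 * ((m j : ℝ) - (a j : ℝ)) with hV
  have hs : 0 < √V := Real.sqrt_pos.2 hσ
  set x := (-lam0 - (1 / 2) * ∑ j, lam j * v j * ((m j : ℝ) + (a j : ℝ))) / √V with hx
  let c : Fin d → ℝ := fun j => lam j * v j / (2 * √V)
  have hc : ∑ k : Σ j, Fin (m j - a j), c k.1 ^ 2 = 1 := by
    rw [Fintype.sum_sigma]
    have (j : Fin d) : c j ^ 2 = (lam j) ^ 2 * (v j) ^ 2 * (1 / 4) / V := by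
      simp only [c, div_pow, mul_pow, Real.sq_sqrt hσ.le]
      ring
    simp only [Finset.sum_const, Finset.card_univ, Fintype.card_fin, nsmul_eq_mul, hsub, this]
    calc ∑ j, ((m j : ℝ) - a j) * ((lam j) ^ 2 * (v j) ^ 2 * (1 / 4) / V) = V / V := by
          conv_rhs => enter [1]; rw [hV]
          rw [Finset.mul_sum, Finset.sum_div]
          exact Finset.sum_congr rfl fun j _ => by ring
      _ = 1 := div_self hσ.ne'
  have hcβ (k : Σ j, Fin (m j - a j)) : |c k.1| ≤ β := by
    simp only [c, abs_div, abs_of_pos (mul_pos two_pos hs)]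
    rw [div_le_iff₀ (mul_pos two_pos hs)]
    linarith [hβ k.1]
  have key := isFlipFamily_blockSign.abs_card_sub_cdf_le hc hβ0 hcβ x
  have hevent (ω : ∀ j, Finset (Fin (m j - a j))) :
      (∑ k : Σ j, Fin (m j - a j), c k.1 * blockSign k ω ≤ x) ↔
        ¬ 0 < lam0 + ∑ j, lam j * v j * ((a j + (ω j).card : ℕ) : ℝ) := by
    rw [sum_blockSign c ω, hx, le_div_iff₀ hs, Finset.sum_mul, not_lt]
    have e1 (j : Fin d) : c j * (2 * (ω j).card - (m j - a j : ℕ)) * √V =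
        lam j * v j * ((a j + (ω j).card : ℕ) : ℝ)
          - (1 / 2) * (lam j * v j * ((m j : ℝ) + (a j : ℝ))) := by
      simp only [c, hsub]
      push_cast
      field_simp
      ring
    simp only [e1, Finset.sum_sub_distrib, ← Finset.mul_sum]
    constructor <;> intro h <;> linarith
  have hN : (Fintype.card (∀ j, Finset (Fin (m j - a j))) : ℝ) ≠ 0 := by
    exact_mod_cast Fintype.card_ne_zero
  have hcompl := Finset.card_filter_add_card_filter_not
    (s := (Finset.univ : Finset (∀ j, Finset (Fin (m j - a j)))))
    (fun ω => 0 < lam0 + ∑ j, lam j * v j * ((a j + (ω j).card : ℕ) : ℝ))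
  rw [Finset.card_univ] at hcompl
  rw [anchorMeasure_toReal_eq]
  simp only [hevent] at key
  simp only [Set.mem_ofPred_eq]
  rw [← hcompl] at key hN ⊢
  push_cast at key hN ⊢
  rw [abs_sub_comm] at key
  convert key using 2
  field_simp
  ring

lemma five_mul_sqrt_two_mul_div_le {R d : ℝ} (hR : 1 ≤ R) (hd : 0 < d) :
    5 * √(2 * R / d) ≤
      (16 * √2 * 0.56 / √Real.pi) * R ^ ((3 : ℝ) / 2) * d ^ (-(1 : ℝ) / 2) := by
  have hpi : √Real.pi ≤ 1.792 := by
    rw [Real.sqrt_le_left (by norm_num)]; nlinarith [Real.pi_lt_d2]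
  have hpi0 : 0 < √Real.pi := Real.sqrt_pos.2 Real.pi_pos
  have e1 : √(2 * R / d) = √2 * R ^ ((1 : ℝ) / 2) * d ^ (-(1 : ℝ) / 2) := by
    rw [Real.sqrt_div (by positivity), Real.sqrt_mul (by norm_num), Real.sqrt_eq_rpow R,
      Real.sqrt_eq_rpow d, neg_div, Real.rpow_neg hd.le]
    ring
  have e2 : 5 * √2 ≤ 16 * √2 * 0.56 / √Real.pi := by
    rw [le_div_iff₀ hpi0]
    nlinarith [Real.sqrt_nonneg 2]
  have e3 : R ^ ((1 : ℝ) / 2) ≤ R ^ ((3 : ℝ) / 2) :=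
    Real.rpow_le_rpow_of_exponent_le hR (by norm_num)
  rw [e1, ← mul_assoc, ← mul_assoc]
  gcongr

lemma one_le_iSup_div_iInf {ι : Type*} [Finite ι] [Nonempty ι] {f : ι → ℝ} (hf : ∀ j, 0 < f j) :
    1 ≤ (⨆ j, f j) / ⨅ j, f j := by
  obtain ⟨i, hi⟩ := exists_eq_ciInf_of_finite (f := f)
  rw [← hi, one_le_div (hf i)]
  exact le_ciSup (Finite.bddAbove_range f) i

/-- **Precision of a linear classifier, Berry–Esseen.** For a linear classifier
with nonzero coefficients `λ_j v_j` and an anchor of length at most `b/2`, the precision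
`P(λ₀ + Σ_j λ_j v_j M_j > 0)` is approximated by `Φ̄(L(a)) = 1 - Φ(L(a))` up to
`C (max λ_j²v_j² / min λ_j²v_j²)^{3/2} (max m_j / min m_j)^{3/2} d^{-1/2}`,
where `C = 16 √2 · 0.56 / √π ≈ 7.15`. -/
theorem statement_6 {d : ℕ} (hd : 1 ≤ d) (m a : Fin d → ℕ) (hm : ∀ j, 1 ≤ m j)
    (ham : ∀ j, a j ≤ m j) (v : Fin d → ℝ) (hv : ∀ j, 0 < v j)
    (lam0 : ℝ) (lam : Fin d → ℝ) (hlam : ∀ j, lam j * v j ≠ 0)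
    (hlen : ((∑ j, a j : ℕ) : ℝ) ≤ ((∑ j, m j : ℕ) : ℝ) / 2) :
    |(anchorMeasure m a
        {ω | 0 < lam0 + ∑ j, lam j * v j * ((a j + ω j : ℕ) : ℝ)}).toReal -
      (1 - stdGaussCDF (Lfun lam0 lam v m a))| ≤
      (16 * Real.sqrt 2 * 0.56 / Real.sqrt Real.pi) *
        ((⨆ j, (lam j)^2 * (v j)^2) / (⨅ j, (lam j)^2 * (v j)^2)) ^ ((3:ℝ)/2) *
        ((⨆ j, (m j : ℝ)) / (⨅ j, (m j : ℝ))) ^ ((3:ℝ)/2) *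
        ((d : ℝ) ^ (-(1:ℝ)/2)) := by
  have : Nonempty (Fin d) := ⟨⟨0, hd⟩⟩
  have hd0 : (0 : ℝ) < d := by exact_mod_cast hd
  set w : Fin d → ℝ := fun j => (lam j) ^ 2 * (v j) ^ 2 with hw
  have hw0 (j : Fin d) : 0 < w j := by
    have := hlam j
    simp only [hw, ← mul_pow]
    positivity
  have hm1 (j : Fin d) : (1 : ℝ) ≤ m j := by exact_mod_cast hm j
  have hR := one_le_iSup_div_iInf hw0
  have hRm := one_le_iSup_div_iInf (f := fun j => (m j : ℝ)) fun j => one_pos.trans_le (hm1 j)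
  obtain ⟨i, hi⟩ := exists_eq_ciInf_of_finite (f := w)
  have hinf (j : Fin d) : w i ≤ w j := by
    rw [hi]; exact ciInf_le (Finite.bddBelow_range w) j
  have hsup (j : Fin d) : w j ≤ ⨆ j, w j := le_ciSup (Finite.bddAbove_range w) j
  have hcount : (d : ℝ) / 2 ≤ ∑ j, ((m j : ℝ) - a j) := by
    have h1 : (d : ℝ) ≤ ∑ j, (m j : ℝ) := by
      simpa using Finset.sum_le_sum fun j (_ : j ∈ Finset.univ) => hm1 j
    push_cast at hlen
    rw [Finset.sum_sub_distrib]
    linarith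
  have hV : w i * d / 8 ≤ (1 / 4) * ∑ j, w j * ((m j : ℝ) - (a j : ℝ)) := by
    have h1 : w i * ∑ j, ((m j : ℝ) - a j) ≤ ∑ j, w j * ((m j : ℝ) - (a j : ℝ)) := by
      rw [Finset.mul_sum]
      refine Finset.sum_le_sum fun j _ => mul_le_mul_of_nonneg_right (hinf j) ?_
      exact sub_nonneg.2 (by exact_mod_cast ham j)
    nlinarith [hw0 i]
  have hV0 : 0 < (1 / 4) * ∑ j, w j * ((m j : ℝ) - (a j : ℝ)) :=
    lt_of_lt_of_le (by have := hw0 i; positivity) hV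
  have hβ0 : 0 < 2 * ((⨆ j, w j) / ⨅ j, w j) / d := by positivity
  have main := abs_anchorMeasure_sub_le m a ham v lam lam0 (Real.sqrt_pos.2 hβ0) hV0 fun j => by
    rw [← Real.sqrt_mul hβ0.le]
    refine Real.le_sqrt_of_sq_le ?_
    have h1 : (|lam j * v j| / 2) ^ 2 = w j / 4 := by
      rw [div_pow, sq_abs, mul_pow]
      norm_num [w]
    rw [h1]
    calc w j / 4 ≤ (⨆ j, w j) / 4 := by gcongr; exact hsup j
      _ = 2 * ((⨆ j, w j) / ⨅ j, w j) / d * (w i * d / 8) := by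
        rw [← hi]
        have := (hw0 i).ne'
        field_simp
        ring
      _ ≤ _ := mul_le_mul_of_nonneg_left hV hβ0.le
  refine main.trans ((five_mul_sqrt_two_mul_div_le hR hd0).trans ?_)
  have h3 := Real.one_le_rpow hRm (show (0 : ℝ) ≤ 3 / 2 by norm_num)
  exact mul_le_mul_of_nonneg_right (le_mul_of_one_le_right (by positivity) h3) (by positivity)
end

section
/- Set γ := λ₀ + Σ_{j=1}^d λ_j v_j m_j and assume γ > 0 and λ₀ > −γ/2. Assume the indices are ordered so that λ_1 v_1 > λ_2 v_2 > ⋯ > λ_d v_d. Let a be an anchor such that λ_j > 0 whenever a_j > 0, and let k < ℓ be indices with λ_k > 0, λ_ℓ > 0, a_k < m_k, and a_ℓ < m_ℓ. Then L(a_1, …, a_k + 1, …, a_ℓ, …, a_d) < L(a_1, …, a_k, …, a_ℓ + 1, …, a_d); that is, adding one occurrence of the word with the larger value of λ_j v_j yields a strictly smaller value of L. -/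
/-- A weighted sum of the entries of `Function.update a k (a k + 1)`. -/
theorem sum_mul_update_succ {d : ℕ} (w : Fin d → ℝ) (a : Fin d → ℕ) (k : Fin d) :
    ∑ j, w j * (Function.update a k (a k + 1) j : ℝ) = ∑ j, w j * (a j : ℝ) + w k := by
  have h : ∀ j, w j * (Function.update a k (a k + 1) j : ℝ) =
      w j * (a j : ℝ) + if j = k then w j else 0 := by
    intro j
    by_cases hj : j = k
    · subst hj
      simp [mul_add]
    · simp [hj]
  simp [h, Finset.sum_add_distrib]

/-- The effect on `Lfun` of adding one occurrence at `k`. -/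
theorem Lfun_update_succ {d : ℕ} (lam0 : ℝ) (lam v : Fin d → ℝ) (m a : Fin d → ℕ) (k : Fin d) :
    Lfun lam0 lam v m (Function.update a k (a k + 1)) =
      -((lam0 + (1/2) * ∑ j, lam j * v j * ((m j : ℝ) + (a j : ℝ)) + (1/2) * (lam k * v k)) /
        Real.sqrt ((1/4) *
          (∑ j, (lam j)^2 * (v j)^2 * ((m j : ℝ) - (a j : ℝ)) - (lam k * v k)^2))) := by
  unfold Lfun
  simp only [mul_add (lam _ * v _), mul_sub (lam _ ^ 2 * v _ ^ 2), Finset.sum_add_distrib,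
    Finset.sum_sub_distrib]
  rw [sum_mul_update_succ (fun j => lam j * v j), sum_mul_update_succ (fun j => lam j^2 * v j^2),
    ← neg_div]
  congr 1
  · ring
  · congr 1
    ring

/-- **Minimization of `L`: swap towards larger `λ_j v_j`.** Assume
`γ = λ₀ + Σ_j λ_j v_j m_j > 0`, `λ₀ > -γ/2`, and that the `λ_j v_j` are strictly decreasing.
For an anchor supported on positive coefficients, and indices `k < ℓ` with `λ_k, λ_ℓ > 0`,
`a k < m k` and `a ℓ < m ℓ`, adding one occurrence at `k` yields a strictly smaller value of
`L` than adding one occurrence at `ℓ`. -/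
theorem statement_8 {d : ℕ} (m a : Fin d → ℕ) (ham : ∀ i, a i ≤ m i) (hm : ∀ i, 1 ≤ m i)
    (v : Fin d → ℝ) (hv : ∀ i, 0 < v i) (lam0 : ℝ) (lam : Fin d → ℝ)
    (hord : ∀ i j : Fin d, i < j → lam j * v j < lam i * v i)
    (hγ : 0 < lam0 + ∑ j, lam j * v j * (m j : ℝ))
    (hlam0 : -(lam0 + ∑ j, lam j * v j * (m j : ℝ)) / 2 < lam0)
    (hpos : ∀ i, 0 < a i → 0 < lam i)
    (k l : Fin d) (hkl : k < l) (hk : 0 < lam k) (hl : 0 < lam l)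
    (hak : a k < m k) (hal : a l < m l) :
    Lfun lam0 lam v m (Function.update a k (a k + 1)) <
      Lfun lam0 lam v m (Function.update a l (a l + 1)) := by
  have hkl' := hord k l hkl
  have hwl : 0 < lam l * v l := mul_pos hl (hv l)
  rw [Lfun_update_succ, Lfun_update_succ, neg_lt_neg_iff]
  have hA : 0 < lam0 + (1/2) * ∑ j, lam j * v j * ((m j : ℝ) + (a j : ℝ)) := by
    have h0 : 0 ≤ ∑ j, lam j * v j * (a j : ℝ) := by
      refine Finset.sum_nonneg fun j _ => ?_
      rcases Nat.eq_zero_or_pos (a j) with h | h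
      · simp [h]
      · have := hpos j h
        have := hv j
        positivity
    simp only [mul_add (lam _ * v _), Finset.sum_add_distrib]
    linarith
  have hB : 0 < ∑ j, (lam j)^2 * (v j)^2 * ((m j : ℝ) - (a j : ℝ)) - (lam k * v k)^2 := by
    have hnn : ∀ j, 0 ≤ (lam j)^2 * (v j)^2 * ((m j : ℝ) - (a j : ℝ)) := fun j =>
      mul_nonneg (by positivity) (sub_nonneg.2 (by exact_mod_cast ham j))
    have hge : ∀ j, a j < m j →
        (lam j * v j)^2 ≤ (lam j)^2 * (v j)^2 * ((m j : ℝ) - (a j : ℝ)) := by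
      intro j hj
      have h1 : (a j : ℝ) + 1 ≤ m j := by exact_mod_cast hj
      rw [mul_pow]
      exact le_mul_of_one_le_right (by positivity) (by linarith)
    have hpair := Finset.add_le_sum (fun j _ => hnn j) (Finset.mem_univ k) (Finset.mem_univ l)
      hkl.ne
    have := hge k hak
    have := hge l hal
    have : 0 < (lam l * v l)^2 := by positivity
    linarith
  have hsq : (lam l * v l)^2 < (lam k * v k)^2 := pow_lt_pow_left₀ hkl' hwl.le two_ne_zero
  exact div_lt_div₀ (by linarith) (Real.sqrt_le_sqrt (by linarith)) (by linarith)
    (Real.sqrt_pos.2 (by linarith))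
end

section
/- Let d ≥ 3 and consider the classifier that outputs 1 if and only if (M_1 > 0 and M_2 > 0) or M_3 > 0, with precision Prec(a) := P((M_1 > 0 and M_2 > 0) or M_3 > 0). Let 𝒜 be the set of all nonzero anchors a with a_j ≤ m_j for all j. Then for any tolerance ε ∈ (0,1), 𝒜₃^{Prec}(ε) = {A}, where A is the anchor with a_3 = 1 and a_j = 0 for all j ≠ 3. -/
open MeasureTheory ProbabilityTheory

theorem binomHalf_singleton_zero_ne_zero (n : ℕ) : binomHalf n {0} ≠ 0 := by
  rw [binomHalf, PMF.toMeasure_apply_singleton _ _ (measurableSet_singleton 0), ← PMF.mem_support_iff,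
    PMF.mem_support_map_iff]
  refine ⟨0, ?_, rfl⟩
  rw [PMF.mem_support_iff, PMF.binomial_apply_zero]
  refine pow_ne_zero _ ?_
  norm_num

theorem anchorMeasure_singleton_zero_ne_zero {d : ℕ} (m a : Fin d → ℕ) :
    anchorMeasure m a {0} ≠ 0 := by
  rw [anchorMeasure, Measure.pi_singleton]
  exact Finset.prod_ne_zero_iff.2 fun j _ => binomHalf_singleton_zero_ne_zero _

theorem anchorMeasure_lt_one_of_zero_notMem {d : ℕ} (m a : Fin d → ℕ) {s : Set (Fin d → ℕ)}
    (hs : 0 ∉ s) : (anchorMeasure m a s).toReal < 1 := by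
  have hlt : anchorMeasure m a s < 1 := by
    refine lt_of_le_of_ne prob_le_one fun h => ?_
    have hsub : s ⊆ {0}ᶜ := Set.subset_compl_singleton_iff.2 hs
    have hone : anchorMeasure m a {0}ᶜ = 1 :=
      le_antisymm prob_le_one (h ▸ measure_mono hsub)
    exact anchorMeasure_singleton_zero_ne_zero m a
      ((prob_compl_eq_one_iff (measurableSet_singleton 0)).1 hone)
  simpa using (ENNReal.toReal_lt_toReal hlt.ne_top ENNReal.one_ne_top).2 hlt

/-- If some anchor `A` has length one and precision one, no anchor has length zero, and every other
anchor of length one has precision below one, then exhaustive Anchors selects exactly `A`. -/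
theorem anchorsA3_eq_singleton {α : Type*} {𝒜 : Finset α} {len : α → ℕ} {p : α → ℝ} {ε : ℝ}
    (hε : 0 ≤ ε) {A : α} (hA : A ∈ 𝒜) (hlen : len A = 1) (hpA : p A = 1)
    (hpos : ∀ B ∈ 𝒜, 1 ≤ len B) (hlt : ∀ B ∈ 𝒜, len B = 1 → B ≠ A → p B < 1) :
    anchorsA3 𝒜 len p ε = {A} := by
  have hA1 : A ∈ anchorsA1 𝒜 p ε := by
    simp only [anchorsA1, Finset.mem_filter]
    exact ⟨hA, by linarith⟩
  have mem_A2 : ∀ B, B ∈ anchorsA2 𝒜 len p ε → B ∈ 𝒜 ∧ len B = 1 := by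
    intro B hB
    simp only [anchorsA2, Finset.mem_filter] at hB
    have hB𝒜 : B ∈ 𝒜 := (Finset.mem_filter.1 hB.1).1
    exact ⟨hB𝒜, le_antisymm (hlen ▸ hB.2 A hA1) (hpos B hB𝒜)⟩
  have hA2 : A ∈ anchorsA2 𝒜 len p ε := by
    simp only [anchorsA2, Finset.mem_filter]
    exact ⟨hA1, fun B hB => hlen ▸ hpos B (Finset.mem_filter.1 hB).1⟩
  ext B
  simp only [anchorsA3, Finset.mem_filter, Finset.mem_singleton]
  constructor
  · rintro ⟨hB, hmax⟩
    by_contra hne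
    have := hlt B (mem_A2 B hB).1 (mem_A2 B hB).2 hne
    linarith [hmax A hA2]
  · rintro rfl
    refine ⟨hA2, fun C hC => ?_⟩
    by_cases hCB : C = B
    · rw [hCB]
    · exact hpA ▸ (hlt C (mem_A2 C hC).1 (mem_A2 C hC).2 hCB).le

/-- **Small decision tree.** For the classifier outputting `1` iff
`(M_1 > 0 and M_2 > 0) or M_3 > 0`, and any tolerance `ε ∈ (0,1)`, exhaustive Anchors
selects exactly the anchor with `a_3 = 1` and all other coordinates `0`. -/
theorem statement_10 {d : ℕ} (hd : 3 ≤ d) (m : Fin d → ℕ) (hm : ∀ j, 1 ≤ m j)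
    (ε : ℝ) (hε : 0 < ε) (hε1 : ε < 1)
    (𝒜 : Finset (Fin d → ℕ))
    (h𝒜 : 𝒜 = (Fintype.piFinset fun j => Finset.range (m j + 1)).filter fun a => a ≠ 0)
    (Prec : (Fin d → ℕ) → ℝ)
    (hPrec : ∀ a : Fin d → ℕ, Prec a =
      (anchorMeasure m a {ω |
        (0 < a ⟨0, by omega⟩ + ω ⟨0, by omega⟩ ∧ 0 < a ⟨1, by omega⟩ + ω ⟨1, by omega⟩) ∨
          0 < a ⟨2, by omega⟩ + ω ⟨2, by omega⟩}).toReal) :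
    anchorsA3 𝒜 (fun a => ∑ j, a j) Prec ε =
      {fun j : Fin d => if (j : ℕ) = 2 then 1 else 0} := by
  have hA : (fun j : Fin d => if (j : ℕ) = 2 then 1 else 0) = Pi.single ⟨2, by omega⟩ 1 := by
    ext j
    simp [Pi.single_apply, Fin.ext_iff]
  rw [hA]
  refine anchorsA3_eq_singleton hε.le ?_ ?_ ?_ ?_ ?_
  · rw [h𝒜, Finset.mem_filter, Fintype.mem_piFinset]
    refine ⟨fun j => ?_, by simp⟩
    have := hm j
    rw [Finset.mem_range, Pi.single_apply]
    split_ifs <;> omega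
  · simp
  · rw [hPrec]
    simp
  · intro B hB
    rw [h𝒜, Finset.mem_filter] at hB
    rw [Nat.one_le_iff_ne_zero]
    intro h
    exact hB.2 (funext fun j => Finset.sum_eq_zero_iff.1 h j (Finset.mem_univ j))
  · intro B _ hlen hne
    have eq_single : ∀ i, 0 < B i → B = Pi.single i 1 := by
      intro i hi
      have hsum := Finset.add_sum_erase Finset.univ B (Finset.mem_univ i)
      ext j
      rw [Pi.single_apply]
      split_ifs with hj
      · subst hj
        omega
      · have := Finset.single_le_sum (f := B) (fun _ _ => Nat.zero_le _)
          (Finset.mem_erase.2 ⟨hj, Finset.mem_univ j⟩)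
        omega
    rw [hPrec]
    apply anchorMeasure_lt_one_of_zero_notMem
    rintro (⟨h0, h1⟩ | h2)
    · have := eq_single _ h0
      rw [this] at h1
      simp at h1
    · exact hne (eq_single _ h2)
end

section
/- Assume 0 < v_min ≤ v_j ≤ v_max and 1 ≤ m_j ≤ M for all j ∈ {1, …, d}, and define D := Σ_{j=1}^d v_j² M_j². Then P(D < (1/4) d v_min²) ≤ 2 exp(−d v_min⁴ / (8 v_max⁴ M⁴)). -/
open MeasureTheory ProbabilityTheory

theorem binomHalf_real_singleton_zero_le {n : ℕ} (hn : 1 ≤ n) :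
    (binomHalf n).real {0} ≤ 1 / 2 := by
  have h0 : ((PMF.binomial (1/2) (by norm_num) n).map Fin.val) 0 = (1 - (1/2 : NNReal)) ^ n := by
    rw [PMF.map_apply, tsum_eq_single (0 : Fin (n + 1))]
    · simp [PMF.binomial_apply]
    · intro b hb
      rw [if_neg]
      intro h
      exact hb (Fin.ext h.symm)
  have h1 : (1 - (1/2 : NNReal)) = 1/2 := by
    apply tsub_eq_of_eq_add
    norm_num
  rw [measureReal_def, binomHalf, PMF.toMeasure_apply_singleton _ _ (measurableSet_singleton _), h0]
  have h2 : (1 - ((1/2 : NNReal) : ENNReal)) = ((1/2 : NNReal) : ENNReal) := by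
    rw [← ENNReal.coe_one, ← ENNReal.coe_sub, h1]
  rw [h2, ENNReal.toReal_pow, ENNReal.coe_toReal]
  simpa using pow_le_pow_of_le_one (by norm_num : (0:ℝ) ≤ 1/2) (by norm_num) hn

/-- The exponential weight of the event that an anchored multiplicity `k` is nonzero. -/
noncomputable def nonzeroWeight (k : ℕ) : ℝ :=
  Real.exp (1 / 4 - if k = 0 then 0 else 1)

theorem integrable_nonzeroWeight (a n : ℕ) :
    Integrable (fun k => nonzeroWeight (a + k)) (binomHalf n) := by
  refine Integrable.of_bound (C := Real.exp (1 / 4)) (by fun_prop) (ae_of_all _ fun k => ?_)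
  rw [nonzeroWeight, Real.norm_eq_abs, Real.abs_exp, Real.exp_le_exp]
  split_ifs <;> norm_num

theorem integral_nonzeroWeight_le {a m : ℕ} (hm : 1 ≤ m) :
    ∫ k, nonzeroWeight (a + k) ∂(binomHalf (m - a)) ≤ Real.exp (-(1 / 8)) := by
  rcases Nat.eq_zero_or_pos a with rfl | ha
  · have hp := binomHalf_real_singleton_zero_le hm
    have hfun : (fun k => nonzeroWeight (0 + k)) = fun k => Real.exp (-(3 / 4)) +
        Set.indicator {0} (fun _ => Real.exp (1 / 4) - Real.exp (-(3 / 4))) k := by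
      funext k
      by_cases hk : k = 0
      · simp [nonzeroWeight, hk]
      · simp [nonzeroWeight, hk]
        norm_num
    rw [hfun, integral_add (integrable_const _)
      ((integrable_const _).indicator (measurableSet_singleton _)),
      integral_indicator_const _ (measurableSet_singleton _)]
    simp only [integral_const, probReal_univ, smul_eq_mul, one_mul, Nat.sub_zero]
    have hc : Real.exp (-(3 / 4)) ≤ Real.exp (1 / 4) := Real.exp_le_exp.2 (by norm_num)
    have hcosh := Real.cosh_le_exp_half_sq (1 / 2)
    rw [Real.cosh_eq] at hcosh
    have hscale := mul_le_mul_of_nonneg_left hcosh (Real.exp_pos (-(1 / 4))).le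
    rw [mul_div_assoc', mul_add, ← Real.exp_add, ← Real.exp_add, ← Real.exp_add] at hscale
    norm_num at hscale ⊢
    nlinarith
  · have hfun : (fun k => nonzeroWeight (a + k)) = fun _ => Real.exp (-(3 / 4)) := by
      funext k
      rw [nonzeroWeight, if_neg (by omega)]
      norm_num
    rw [hfun]
    simp only [integral_const, probReal_univ, smul_eq_mul, one_mul]
    exact Real.exp_le_exp.2 (by norm_num)

/-- Chernoff bound for the event that fewer than a quarter of the multiplicities are nonzero. -/
theorem anchorMeasure_real_nonzero_lt_le {d : ℕ} (m a : Fin d → ℕ) (hm : ∀ j, 1 ≤ m j) :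
    (anchorMeasure m a).real {ω | (∑ j, if a j + ω j = 0 then (0 : ℝ) else 1) < (1 / 4) * d} ≤
      Real.exp (-(d / 8)) := by
  set F : (Fin d → ℕ) → ℝ := fun ω => ∏ j, nonzeroWeight (a j + ω j)
  have hF : Integrable F (anchorMeasure m a) :=
    Integrable.fintype_prod fun j => integrable_nonzeroWeight (a j) (m j - a j)
  have hmarkov := mul_meas_ge_le_integral_of_nonneg
    (ae_of_all _ fun ω => Finset.prod_nonneg fun j _ => (Real.exp_pos _).le) hF 1
  rw [one_mul] at hmarkov
  calc _ ≤ (anchorMeasure m a).real {ω | 1 ≤ F ω} := by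
        refine measureReal_mono fun ω hω => ?_
        simp only [Set.mem_ofPred_eq, F, nonzeroWeight] at hω ⊢
        rw [← Real.exp_sum, Real.one_le_exp_iff, Finset.sum_sub_distrib]
        simp only [Finset.sum_const, Finset.card_univ, Fintype.card_fin, nsmul_eq_mul]
        linarith
    _ ≤ ∫ ω, F ω ∂anchorMeasure m a := hmarkov
    _ = ∏ j, ∫ k, nonzeroWeight (a j + k) ∂binomHalf (m j - a j) :=
        integral_fintype_prod_eq_prod (μ := fun j => binomHalf (m j - a j))
          (fun j k => nonzeroWeight (a j + k))
    _ ≤ ∏ _j : Fin d, Real.exp (-(1 / 8)) :=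
        Finset.prod_le_prod (fun j _ => integral_nonneg fun k => (Real.exp_pos _).le)
          fun j _ => integral_nonzeroWeight_le (hm j)
    _ = Real.exp (-(d / 8)) := by
        rw [← Real.exp_sum]
        simp [div_eq_mul_inv]

/-- **`D` is not too small with high probability.** With `D = Σ_j v_j² M_j²`,
`P(D < (1/4) d v_min²) ≤ 2 exp(-d v_min⁴ / (8 v_max⁴ M⁴))`. -/
theorem statement_13 {d : ℕ} (m a : Fin d → ℕ) (ham : ∀ j, a j ≤ m j)
    (M : ℕ) (vmin vmax : ℝ) (hvmin : 0 < vmin) (v : Fin d → ℝ)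
    (hv : ∀ j, vmin ≤ v j ∧ v j ≤ vmax) (hm : ∀ j, 1 ≤ m j ∧ m j ≤ M) :
    (anchorMeasure m a {ω |
      (∑ j, (v j)^2 * ((a j + ω j : ℕ) : ℝ)^2) < (1/4) * d * vmin^2}).toReal ≤
      2 * Real.exp (-(d * vmin^4) / (8 * vmax^4 * (M : ℝ)^4)) := by
  have hsub : {ω : Fin d → ℕ |
      (∑ j, (v j)^2 * ((a j + ω j : ℕ) : ℝ)^2) < (1/4) * d * vmin^2} ⊆
      {ω | (∑ j, if a j + ω j = 0 then (0 : ℝ) else 1) < (1 / 4) * d} := by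
    intro ω hω
    rw [Set.mem_ofPred_eq] at hω ⊢
    refine lt_of_mul_lt_mul_right (lt_of_le_of_lt ?_ hω) (sq_nonneg vmin)
    rw [Finset.sum_mul]
    refine Finset.sum_le_sum fun j _ => ?_
    split_ifs with h
    · rw [zero_mul]
      positivity
    · have h1 : (1 : ℝ) ≤ ((a j + ω j : ℕ) : ℝ) := by exact_mod_cast Nat.one_le_iff_ne_zero.2 h
      have h2 : vmin ^ 2 ≤ v j ^ 2 := pow_le_pow_left₀ hvmin.le (hv j).1 2
      rw [one_mul]
      exact h2.trans (le_mul_of_one_le_right (sq_nonneg _) (one_le_pow₀ h1))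
  have hexp : Real.exp (-(d / 8)) ≤
      Real.exp (-(d * vmin^4) / (8 * vmax^4 * (M : ℝ)^4)) := by
    rcases Nat.eq_zero_or_pos d with rfl | hd
    · simp
    · have hvm : vmin ≤ vmax := (hv ⟨0, hd⟩).1.trans (hv ⟨0, hd⟩).2
      have hM : (1 : ℝ) ≤ M := by exact_mod_cast (hm ⟨0, hd⟩).1.trans (hm ⟨0, hd⟩).2
      have hvmax : 0 < vmax := hvmin.trans_le hvm
      have h4 : vmin ^ 4 ≤ vmax ^ 4 * (M : ℝ) ^ 4 :=
        (pow_le_pow_left₀ hvmin.le hvm 4).trans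
          (le_mul_of_one_le_right (by positivity) (one_le_pow₀ hM))
      rw [Real.exp_le_exp, neg_div, neg_le_neg_iff, div_le_div_iff₀ (by positivity) (by norm_num)]
      have := mul_le_mul_of_nonneg_left h4 (Nat.cast_nonneg (α := ℝ) d)
      linarith
  calc _ ≤ (anchorMeasure m a).real
          {ω | (∑ j, if a j + ω j = 0 then (0 : ℝ) else 1) < (1 / 4) * d} := measureReal_mono hsub
    _ ≤ Real.exp (-(d / 8)) := anchorMeasure_real_nonzero_lt_le m a fun j => (hm j).1
    _ ≤ _ := hexp.trans (by linarith [Real.exp_pos (-(d * vmin^4) / (8 * vmax^4 * (M : ℝ)^4))])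
end

section
/- Let m ≥ 2 be an even integer and B ~ Binomial(m, 1/2). Then the third absolute central moment of B satisfies E[|B − m/2|³] = (m² / 2^{m+2}) · C(m, m/2), where C(m, m/2) is the central binomial coefficient. -/
open MeasureTheory ProbabilityTheory

theorem integral_binomHalf (n : ℕ) (f : ℕ → ℝ) :
    ∫ k, f k ∂(binomHalf n) = (∑ k ∈ Finset.range (n + 1), (n.choose k : ℝ) * f k) / 2 ^ n := by
  unfold binomHalf
  rw [← PMF.toMeasure_map _ _ (measurable_of_finite _),
    integral_map (measurable_of_finite _).aemeasurable (by fun_prop), PMF.integral_eq_sum,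
    Finset.sum_range, Finset.sum_div]
  refine Finset.sum_congr rfl fun i _ => ?_
  have hi : (i : ℕ) + (n - i) = n := by omega
  have hhalf : (1 : ENNReal) - ((1 / 2 : NNReal) : ENNReal) = ((1 / 2 : NNReal) : ENNReal) := by
    rw [← ENNReal.coe_one, ← ENNReal.coe_sub, ENNReal.coe_inj]
    exact tsub_eq_of_eq_add (add_halves 1).symm
  rw [PMF.binomial_apply, hhalf, ← pow_add, Fin.val_last, hi]
  simp [div_eq_mul_inv]
  ring

/-- A closed form for the partial sums of the third central moment of `Binomial(2n, 1/2)`. -/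
theorem sum_range_choose_mul_sub_pow_three (n j : ℕ) :
    ∑ k ∈ Finset.range j, ((2 * n).choose k : ℝ) * ((n : ℝ) - k) ^ 3 =
      j * ((j : ℝ) ^ 2 / 2 - (n + 1 / 2) * j + (n ^ 2 / 2 + n)) * (2 * n).choose j := by
  induction j with
  | zero => simp
  | succ j ih =>
    have h : ((2 * n).choose (j + 1) : ℝ) * (j + 1) = (2 * n).choose j * (2 * n - j) := by
      rcases le_or_gt j (2 * n) with hj | hj
      · have := Nat.choose_succ_right_eq (2 * n) j
        have h' : (((2 * n - j : ℕ)) : ℝ) = 2 * n - j := by push_cast [hj]; ring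
        rw [← h']
        exact_mod_cast this
      · simp [Nat.choose_eq_zero_of_lt hj, Nat.choose_eq_zero_of_lt (hj.trans j.lt_succ_self)]
    rw [Finset.sum_range_succ, ih]
    push_cast
    linear_combination
      -(((j : ℝ) + 1) ^ 2 / 2 - (n + 1 / 2) * (j + 1) + (n ^ 2 / 2 + n)) * h

theorem sum_range_choose_mul_abs_sub_pow_three (n : ℕ) :
    ∑ k ∈ Finset.range (2 * n + 1), ((2 * n).choose k : ℝ) * |(k : ℝ) - n| ^ 3 =
      n ^ 2 * (2 * n).choose n := by
  have hlow : ∑ k ∈ Finset.range n, ((2 * n).choose k : ℝ) * |(k : ℝ) - n| ^ 3 =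
      ∑ k ∈ Finset.range n, ((2 * n).choose k : ℝ) * ((n : ℝ) - k) ^ 3 := by
    refine Finset.sum_congr rfl fun k hk => ?_
    have : (k : ℝ) ≤ n := by exact_mod_cast (Finset.mem_range.mp hk).le
    rw [abs_of_nonpos (by linarith), neg_sub]
  have hhigh : ∑ k ∈ Finset.Ico n (2 * n + 1), ((2 * n).choose k : ℝ) * |(k : ℝ) - n| ^ 3 =
      -∑ k ∈ Finset.Ico n (2 * n + 1), ((2 * n).choose k : ℝ) * ((n : ℝ) - k) ^ 3 := by
    rw [← Finset.sum_neg_distrib]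
    refine Finset.sum_congr rfl fun k hk => ?_
    have : (n : ℝ) ≤ k := by exact_mod_cast (Finset.mem_Ico.mp hk).1
    rw [abs_of_nonneg (by linarith)]
    ring
  have hn : n ≤ 2 * n + 1 := by omega
  rw [← Finset.sum_range_add_sum_Ico _ hn, hlow, hhigh, Finset.sum_Ico_eq_sub _ hn]
  simp only [sum_range_choose_mul_sub_pow_three, Nat.choose_succ_self]
  push_cast
  ring

/-- **Third absolute central moment of the binomial, even case.** For even
`m ≥ 2` and `B ~ Binomial(m, 1/2)`, `E[|B - m/2|³] = (m²/2^{m+2}) C(m, m/2)`. -/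
theorem statement_16 (m : ℕ) (hm : 2 ≤ m) (heven : Even m) :
    (∫ k, |(k : ℝ) - m/2|^3 ∂(binomHalf m)) =
      ((m : ℝ)^2 / 2^(m+2)) * (m.choose (m/2) : ℝ) := by
  obtain ⟨n, rfl⟩ := heven.exists_two_nsmul
  have hhalf : ((2 * n : ℕ) : ℝ) / 2 = n := by push_cast; ring
  simp only [smul_eq_mul] at *
  rw [integral_binomHalf, hhalf, sum_range_choose_mul_abs_sub_pow_three,
    Nat.mul_div_cancel_left n two_pos]
  push_cast
  field_simp
  ring
end
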